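/- Let f : [0,∞) → [0,∞) be a nonnegative continuous function, C > 0 a constant, and g, h : [0,∞) → [0,∞) nonnegative continuous functions such that f(t) ≤ C + g(t)·f(t) + ∫₀ᵗ h(s)·f(s) ds for all t ≥ 0. Assume that there exists t₀ > 0 such that g(t) ≤ 1/2 for all t > t₀. Then for all t ≥ 0, f(t) ≤ (2C + sup_{0 ≤ s ≤ t₀} f(s)) · exp(2 ∫₀ᵗ h(s) ds). -/

import Mathlib

open MeasureTheory Filter

theorem ContinuousOn.hasDerivAt_integral_of_mem_Ioi {k : ℝ → ℝ} {a x : ℝ}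
    (hk : ContinuousOn k (Set.Ici a)) (hx : a < x) :
    HasDerivAt (fun t => ∫ s in a..t, k s) (k x) x := by
  have hk' : ContinuousOn k (Set.Ioi a) := hk.mono Set.Ioi_subset_Ici_self
  refine intervalIntegral.integral_hasDerivAt_right ?_
    (hk'.stronglyMeasurableAtFilter isOpen_Ioi x hx) (hk'.continuousAt (Ioi_mem_nhds hx))
  refine (hk.mono ?_).intervalIntegrable
  rw [Set.uIcc_of_le hx.le]
  exact Set.Icc_subset_Ici_self

theorem ContinuousOn.continuousOn_integral_Ici {k : ℝ → ℝ} {a : ℝ}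
    (hk : ContinuousOn k (Set.Ici a)) :
    ContinuousOn (fun t => ∫ s in a..t, k s) (Set.Ici a) := by
  intro x hx
  have hab : a ≤ x + 1 := by linarith [Set.mem_Ici.mp hx]
  have hcont : ContinuousOn (fun t => ∫ s in a..t, k s) (Set.uIcc a (x + 1)) := by
    refine intervalIntegral.continuousOn_primitive_interval ?_
    rw [Set.uIcc_of_le hab]
    exact (hk.mono Set.Icc_subset_Ici_self).integrableOn_Icc
  rw [Set.uIcc_of_le hab] at hcont
  refine (hcont x ⟨hx, by linarith⟩).mono_of_mem_nhdsWithin ?_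
  rw [← Set.Ici_inter_Iic]
  exact inter_mem_nhdsWithin _ (Iic_mem_nhds (by linarith))

/-- Integral form of Grönwall's inequality with a continuous nonnegative kernel. -/
theorem le_mul_exp_integral_of_le_add_integral {u k : ℝ → ℝ} {a K : ℝ}
    (hu : ContinuousOn u (Set.Ici a)) (hk : ContinuousOn k (Set.Ici a))
    (hk_nonneg : ∀ t ∈ Set.Ici a, 0 ≤ k t)
    (hle : ∀ t ≥ a, u t ≤ K + ∫ s in a..t, k s * u s) :
    ∀ t ≥ a, u t ≤ K * Real.exp (∫ s in a..t, k s) := by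
  have hanti : AntitoneOn
      (fun t => (K + ∫ s in a..t, k s * u s) * Real.exp (-∫ s in a..t, k s)) (Set.Ici a) := by
    refine antitoneOn_of_hasDerivWithinAt_nonpos (convex_Ici a)
      ((continuousOn_const.add (hk.mul hu).continuousOn_integral_Ici).mul
        hk.continuousOn_integral_Ici.neg.rexp)
      (fun x hx => ?_) (fun x hx => ?_)
      (f' := fun x => k x * u x * Real.exp (-∫ s in a..x, k s) +
        (K + ∫ s in a..x, k s * u s) * (Real.exp (-∫ s in a..x, k s) * -k x))
    · rw [interior_Ici] at hx
      exact ((((hk.mul hu).hasDerivAt_integral_of_mem_Ioi hx).const_add K).mul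
        (hk.hasDerivAt_integral_of_mem_Ioi hx).neg.exp).hasDerivWithinAt
    · rw [interior_Ici] at hx
      have hx' : a ≤ x := le_of_lt hx
      have := mul_nonneg (mul_nonneg (hk_nonneg x hx') (sub_nonneg.mpr (hle x hx')))
        (Real.exp_pos (-∫ s in a..x, k s)).le
      linarith
  intro t ht
  have hG := hanti Set.self_mem_Ici ht ht
  simp only [intervalIntegral.integral_same, neg_zero, Real.exp_zero, add_zero, mul_one] at hG
  rw [Real.exp_neg, ← div_eq_mul_inv, div_le_iff₀ (Real.exp_pos _)] at hG
  exact (hle t ht).trans hG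

/-- Explicit quantitative Grönwall-type bound in the case β = 1: if `g t ≤ 1/2`
for `t > t₀`, then `f t ≤ (2C + sup_{0 ≤ s ≤ t₀} f s) · exp(2 ∫₀ᵗ h)` for all `t ≥ 0`. -/
theorem gronwall_beta_one_explicit
    (f g h : ℝ → ℝ) (C : ℝ) (hC : 0 < C)
    (hf_cont : ContinuousOn f (Set.Ici 0))
    (hg_cont : ContinuousOn g (Set.Ici 0))
    (hh_cont : ContinuousOn h (Set.Ici 0))
    (hf_nonneg : ∀ t ∈ Set.Ici (0:ℝ), 0 ≤ f t)
    (hg_nonneg : ∀ t ∈ Set.Ici (0:ℝ), 0 ≤ g t)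
    (hh_nonneg : ∀ t ∈ Set.Ici (0:ℝ), 0 ≤ h t)
    (hineq : ∀ t ≥ (0:ℝ), f t ≤ C + g t * f t + ∫ s in (0:ℝ)..t, h s * f s)
    (t₀ : ℝ) (ht₀ : 0 < t₀) (hg_small : ∀ t > t₀, g t ≤ 1 / 2) :
    ∀ t ≥ (0:ℝ),
      f t ≤ (2 * C + sSup (f '' Set.Icc 0 t₀)) * Real.exp (2 * ∫ s in (0:ℝ)..t, h s) := by
  have hbdd : BddAbove (f '' Set.Icc 0 t₀) :=
    isCompact_Icc.bddAbove_image (hf_cont.mono Set.Icc_subset_Ici_self)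
  have hle_sup : ∀ t ∈ Set.Icc 0 t₀, f t ≤ sSup (f '' Set.Icc 0 t₀) :=
    fun t ht => le_csSup hbdd (Set.mem_image_of_mem f ht)
  have hsup_nonneg : 0 ≤ sSup (f '' Set.Icc 0 t₀) :=
    (hf_nonneg 0 Set.self_mem_Ici).trans (hle_sup 0 ⟨le_rfl, ht₀.le⟩)
  have key := le_mul_exp_integral_of_le_add_integral
    (u := f) (k := fun s => 2 * h s) (a := 0) (K := 2 * C + sSup (f '' Set.Icc 0 t₀))
    hf_cont (hh_cont.const_mul 2) (fun t ht => mul_nonneg zero_le_two (hh_nonneg t ht)) ?_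
  · simpa only [intervalIntegral.integral_const_mul] using key
  intro t ht
  simp only [mul_assoc, intervalIntegral.integral_const_mul]
  rcases le_or_gt t t₀ with htt | htt
  · have hint : 0 ≤ ∫ s in (0:ℝ)..t, h s * f s :=
      intervalIntegral.integral_nonneg ht fun s hs =>
        mul_nonneg (hh_nonneg s hs.1) (hf_nonneg s hs.1)
    linarith [hle_sup t ⟨ht, htt⟩]
  · have hgf := mul_le_mul_of_nonneg_right (hg_small t htt) (hf_nonneg t ht)
    linarith [hineq t ht]
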